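/- For every horizon N ≥ 1: T ⊆ F_N, and F_N ⊆ F_{N+1}; in particular F_{N+l} ⊇ F_N ⊇ F_1 ⊇ T for all l ≥ 0, and F_N is nonempty whenever T is nonempty. -/

import Mathlib

open Matrix Set

noncomputable section

/-- State trajectory generated by dynamics `x(k+1) = A x(k) + B u(k)` from `x0`. -/
def traj {n m : ℕ} (A : Matrix (Fin n) (Fin n) ℝ) (B : Matrix (Fin n) (Fin m) ℝ)
    (x0 : Fin n → ℝ) (u : ℕ → Fin m → ℝ) : ℕ → Fin n → ℝ
  | 0 => x0
  | k + 1 => A *ᵥ traj A B x0 u k + B *ᵥ u k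

/-- Feasibility of a control sequence for horizon `N` and initial state `x0`. -/
def Feasible {n m qX qU qT : ℕ} (A : Matrix (Fin n) (Fin n) ℝ) (B : Matrix (Fin n) (Fin m) ℝ)
    (Cx : Matrix (Fin qX) (Fin n) ℝ) (cx : Fin qX → ℝ)
    (Cu : Matrix (Fin qU) (Fin m) ℝ) (cu : Fin qU → ℝ)
    (Ct : Matrix (Fin qT) (Fin n) ℝ) (ct : Fin qT → ℝ)
    (N : ℕ) (x0 : Fin n → ℝ) (u : ℕ → Fin m → ℝ) : Prop :=
  (∀ k < N, Cx *ᵥ traj A B x0 u k ≤ cx ∧ Cu *ᵥ u k ≤ cu) ∧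
    Ct *ᵥ traj A B x0 u N ≤ ct

/-- The quadratic cost `J_N(x0, u)`. -/
def cost {n m : ℕ} (A : Matrix (Fin n) (Fin n) ℝ) (B : Matrix (Fin n) (Fin m) ℝ)
    (Q : Matrix (Fin n) (Fin n) ℝ) (R : Matrix (Fin m) (Fin m) ℝ)
    (P : Matrix (Fin n) (Fin n) ℝ)
    (N : ℕ) (x0 : Fin n → ℝ) (u : ℕ → Fin m → ℝ) : ℝ :=
  (1 / 2) * (traj A B x0 u N ⬝ᵥ (P *ᵥ traj A B x0 u N)) +
    (1 / 2) * ∑ k ∈ Finset.range N,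
      (traj A B x0 u k ⬝ᵥ (Q *ᵥ traj A B x0 u k) + u k ⬝ᵥ (R *ᵥ u k))

/-- `u` is an optimal (feasible, cost-minimizing) sequence for horizon `N` at `x0`. -/
def IsOptimal {n m qX qU qT : ℕ} (A : Matrix (Fin n) (Fin n) ℝ) (B : Matrix (Fin n) (Fin m) ℝ)
    (Q : Matrix (Fin n) (Fin n) ℝ) (R : Matrix (Fin m) (Fin m) ℝ)
    (P : Matrix (Fin n) (Fin n) ℝ)
    (Cx : Matrix (Fin qX) (Fin n) ℝ) (cx : Fin qX → ℝ)
    (Cu : Matrix (Fin qU) (Fin m) ℝ) (cu : Fin qU → ℝ)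
    (Ct : Matrix (Fin qT) (Fin n) ℝ) (ct : Fin qT → ℝ)
    (N : ℕ) (x0 : Fin n → ℝ) (u : ℕ → Fin m → ℝ) : Prop :=
  Feasible A B Cx cx Cu cu Ct ct N x0 u ∧
    ∀ v, Feasible A B Cx cx Cu cu Ct ct N x0 v →
      cost A B Q R P N x0 u ≤ cost A B Q R P N x0 v

/-- The feasible set `F_N` of initial states. -/
def FeasSet {n m qX qU qT : ℕ} (A : Matrix (Fin n) (Fin n) ℝ) (B : Matrix (Fin n) (Fin m) ℝ)
    (Cx : Matrix (Fin qX) (Fin n) ℝ) (cx : Fin qX → ℝ)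
    (Cu : Matrix (Fin qU) (Fin m) ℝ) (cu : Fin qU → ℝ)
    (Ct : Matrix (Fin qT) (Fin n) ℝ) (ct : Fin qT → ℝ)
    (N : ℕ) : Set (Fin n → ℝ) :=
  {x0 | ∃ u, Feasible A B Cx cx Cu cu Ct ct N x0 u}

theorem traj_congr {n m : ℕ} (A : Matrix (Fin n) (Fin n) ℝ) (B : Matrix (Fin n) (Fin m) ℝ)
    (x0 : Fin n → ℝ) {u v : ℕ → Fin m → ℝ} {k : ℕ} (h : ∀ j < k, u j = v j) :
    traj A B x0 u k = traj A B x0 v k := by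
  induction k with
  | zero => rfl
  | succ k ih =>
    rw [traj, traj, ih fun j hj => h j (by omega), h k (by omega)]

/-- If a feedback `K` respects the constraints on the terminal set and leaves it invariant,
then the feasible sets increase with the horizon. -/
theorem monotone_feasSet {n m qX qU qT : ℕ}
    (A : Matrix (Fin n) (Fin n) ℝ) (B : Matrix (Fin n) (Fin m) ℝ)
    (Cx : Matrix (Fin qX) (Fin n) ℝ) (cx : Fin qX → ℝ)
    (Cu : Matrix (Fin qU) (Fin m) ℝ) (cu : Fin qU → ℝ)
    (Ct : Matrix (Fin qT) (Fin n) ℝ) (ct : Fin qT → ℝ)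
    (K : Matrix (Fin m) (Fin n) ℝ)
    (hK : ∀ x, Ct *ᵥ x ≤ ct →
      Cx *ᵥ x ≤ cx ∧ Cu *ᵥ (K *ᵥ x) ≤ cu ∧ Ct *ᵥ (A *ᵥ x + B *ᵥ (K *ᵥ x)) ≤ ct) :
    Monotone (FeasSet A B Cx cx Cu cu Ct ct) := by
  refine monotone_nat_of_le_succ fun N x0 ⟨u, hu, hN⟩ => ?_
  set v := Function.update u N (K *ᵥ traj A B x0 u N)
  have hvlt : ∀ j < N, v j = u j := fun j hj => Function.update_of_ne hj.ne _ _
  have hvN : v N = K *ᵥ traj A B x0 u N := Function.update_self _ _ _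
  have htraj : ∀ k ≤ N, traj A B x0 v k = traj A B x0 u k := fun k hk =>
    traj_congr A B x0 fun j hj => hvlt j (hj.trans_le hk)
  obtain ⟨h1, h2, h3⟩ := hK _ hN
  refine ⟨v, fun k hk => ?_, ?_⟩
  · rcases Nat.lt_succ_iff_lt_or_eq.mp hk with hk | rfl
    · rw [htraj k hk.le, hvlt k hk]
      exact hu k hk
    · rw [htraj k le_rfl, hvN]
      exact ⟨h1, h2⟩
  · rw [traj, htraj N le_rfl, hvN]
    exact h3

/-- `T ⊆ F_N` and `F_N ⊆ F_{N+1}`; in particular `F_{N+l} ⊇ F_N ⊇ F_1 ⊇ T`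
and `F_N` is nonempty whenever `T` is. -/
theorem stmt14
    {n m qX qU qT : ℕ}
    (A : Matrix (Fin n) (Fin n) ℝ) (B : Matrix (Fin n) (Fin m) ℝ)
    (Q : Matrix (Fin n) (Fin n) ℝ) (R : Matrix (Fin m) (Fin m) ℝ)
    (P : Matrix (Fin n) (Fin n) ℝ)
    (Cx : Matrix (Fin qX) (Fin n) ℝ) (cx : Fin qX → ℝ)
    (Cu : Matrix (Fin qU) (Fin m) ℝ) (cu : Fin qU → ℝ)
    (Ct : Matrix (Fin qT) (Fin n) ℝ) (ct : Fin qT → ℝ)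
    (hQ : Q.PosSemidef) (hR : R.PosDef) (hP : P.PosSemidef)
    (Kinf : Matrix (Fin m) (Fin n) ℝ)
    (hdet : IsUnit (R + Bᵀ * P * B).det)
    (hRic : P = Aᵀ * (P - P * B * (R + Bᵀ * P * B)⁻¹ * (Bᵀ * P)) * A + Q)
    (hK : Kinf = -((Bᵀ * P * B + R)⁻¹ * (Bᵀ * P * A)))
    (Xs : Set (Fin n → ℝ)) (hXs : Xs = {x | Cx *ᵥ x ≤ cx})
    (Us : Set (Fin m → ℝ)) (hUs : Us = {v | Cu *ᵥ v ≤ cu})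
    (Ts : Set (Fin n → ℝ)) (hTs : Ts = {x | Ct *ᵥ x ≤ ct})
    (XU : Set (Fin n → ℝ)) (hXU : XU = {x ∈ Xs | Kinf *ᵥ x ∈ Us})
    (hTchar : Ts = {x ∈ Xs | ∀ k : ℕ, ((A + B * Kinf) ^ k) *ᵥ x ∈ XU})
    :
    ∀ N : ℕ, 1 ≤ N →
      Ts ⊆ FeasSet A B Cx cx Cu cu Ct ct N ∧
      FeasSet A B Cx cx Cu cu Ct ct N ⊆ FeasSet A B Cx cx Cu cu Ct ct (N + 1) ∧
      (∀ l : ℕ, FeasSet A B Cx cx Cu cu Ct ct N ⊆ FeasSet A B Cx cx Cu cu Ct ct (N + l)) ∧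
      Ts ⊆ FeasSet A B Cx cx Cu cu Ct ct 1 ∧
      FeasSet A B Cx cx Cu cu Ct ct 1 ⊆ FeasSet A B Cx cx Cu cu Ct ct N ∧
      (Ts.Nonempty → (FeasSet A B Cx cx Cu cu Ct ct N).Nonempty) := by
  have hinv : ∀ x, Ct *ᵥ x ≤ ct → Cx *ᵥ x ≤ cx ∧ Cu *ᵥ (Kinf *ᵥ x) ≤ cu ∧
      Ct *ᵥ (A *ᵥ x + B *ᵥ (Kinf *ᵥ x)) ≤ ct := by
    intro x hx
    have hxT : x ∈ Ts := by rw [hTs]; exact hx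
    rw [hTchar] at hxT
    have hXU' : ∀ y ∈ XU, Cx *ᵥ y ≤ cx ∧ Cu *ᵥ (Kinf *ᵥ y) ≤ cu := by
      intro y hy
      rw [hXU, hXs, hUs] at hy
      exact hy
    have h0 := hXU' x (by simpa using hxT.2 0)
    refine ⟨h0.1, h0.2, ?_⟩
    have hstep : A *ᵥ x + B *ᵥ (Kinf *ᵥ x) = (A + B * Kinf) *ᵥ x := by
      rw [add_mulVec, mulVec_mulVec]
    suffices h : (A + B * Kinf) *ᵥ x ∈ Ts by
      rw [hTs] at h
      rw [hstep]
      exact h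
    rw [hTchar]
    refine ⟨?_, fun k => ?_⟩
    · rw [hXs]
      exact (hXU' _ (by simpa using hxT.2 1)).1
    · rw [mulVec_mulVec, ← pow_succ]
      exact hxT.2 (k + 1)
  have hmono := monotone_feasSet A B Cx cx Cu cu Ct ct Kinf hinv
  have hT : ∀ N, Ts ⊆ FeasSet A B Cx cx Cu cu Ct ct N := by
    intro N x hx
    rw [hTs] at hx
    exact hmono N.zero_le ⟨fun _ => 0, fun k hk => absurd hk k.not_lt_zero, hx⟩
  exact fun N hN => ⟨hT N, hmono N.le_succ, fun l => hmono (N.le_add_right l), hT 1, hmono hN,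
    fun h => h.mono (hT N)⟩
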